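/- Consider the consensus game defined below, and let (C^e_[1],…,C^e_[M]) be a profile with J_i^consensus = 0 for every i ∈ Fin M (i.e., w_{ij} |δ_{ij}(C^e_[i]) − δ_{ij}(C^e_[j])| = 0 for all i and all j ∈ M_i). Suppose there is γ with 0 < γ < 1 such that ρ σ_{ij} ≤ γ for all i, j. Let i ∈ Fin M and let C be an opinion that refines C^e_[i] (C ⪯ C^e_[i]) such that γ ε Σ_{j∈M_i} (δ_{ij}(C) − δ_{ij}(C^e_[i])) ≤ (1 − γ) Σ_{j∈M_i} w_{ij} (δ_{ij}(C) − δ_{ij}(C^e_[i])). Then φ(C^e_[1],…,C,…,C^e_[M]) ≥ φ(C^e_[1],…,C^e_[M]), where C is placed in the i-th coordinate. (Refinement case in the proof of Theorem 4: under ρσ_{ij} < 1 and sufficiently small ε, a zero-consensus profile is a Nash equilibrium against comparable deviations.) -/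

import Mathlib

open Finset

namespace ConsensusGame

/-- `delta C i j` is `0` if the partition (equivalence relation) `C` relates `i` and `j`,
and `1` otherwise. -/
noncomputable def delta {M : ℕ} (C : Setoid (Fin M)) (i j : Fin M) : ℝ :=
  open Classical in if C.r i j then 0 else 1

/-- Subsystem `i`'s objective `J_i = J_i^consensus + ρ·J_i^power` at the profile `P`. -/
noncomputable def Jcost {M : ℕ} (Mi : Fin M → Finset (Fin M)) (w σ : Fin M → Fin M → ℝ)
    (ρ ε : ℝ) (i : Fin M) (P : Fin M → Setoid (Fin M)) : ℝ :=
  (∑ j ∈ Mi i, w i j * |delta (P i) i j - delta (P j) i j|)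
    + ρ * ∑ j ∈ Mi i, (w i j + ε) * σ i j * (1 - delta (P i) i j)

/-- The potential function `φ(C_[1],…,C_[M]) = (1/2) Σ_i J_i`. -/
noncomputable def potential {M : ℕ} (Mi : Fin M → Finset (Fin M)) (w σ : Fin M → Fin M → ℝ)
    (ρ ε : ℝ) (P : Fin M → Setoid (Fin M)) : ℝ :=
  (1 / 2) * ∑ i : Fin M, Jcost Mi w σ ρ ε i P

/-- `D` refines `C` (written `D ⪯ C`): whenever `D` relates `i` and `j`, so does `C`. -/
def Refines {M : ℕ} (D C : Setoid (Fin M)) : Prop :=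
  ∀ i j : Fin M, D.r i j → C.r i j

theorem Refines.delta_le {M : ℕ} {D C : Setoid (Fin M)} (h : Refines D C) (i j : Fin M) :
    delta C i j ≤ delta D i j := by
  unfold delta
  split_ifs with hC hD hD
  · exact le_rfl
  · exact zero_le_one
  · exact absurd (h i j hD) hC
  · exact le_rfl

/-- At a zero-consensus profile, a deviation by `i` cannot decrease the objective of another
subsystem. -/
theorem Jcost_le_update_of_ne {M : ℕ} {Mi : Fin M → Finset (Fin M)} {w σ : Fin M → Fin M → ℝ}
    {ρ ε : ℝ} {Pe : Fin M → Setoid (Fin M)} {i k : Fin M} (hki : k ≠ i)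
    (hw_nonneg : ∀ j, 0 ≤ w k j)
    (hcons : ∀ j ∈ Mi k, w k j * |delta (Pe k) k j - delta (Pe j) k j| = 0)
    (C : Setoid (Fin M)) :
    Jcost Mi w σ ρ ε k Pe ≤ Jcost Mi w σ ρ ε k (Function.update Pe i C) := by
  unfold Jcost
  rw [Function.update_of_ne hki, Finset.sum_eq_zero hcons]
  gcongr
  exact Finset.sum_nonneg fun j _ => mul_nonneg (hw_nonneg j) (abs_nonneg _)

/-- At a zero-consensus profile, a refinement deviation by `i` cannot decrease the objective of
`i` itself when `ρσ_{ij} ≤ γ` and `ε` is small. -/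
theorem Jcost_le_update_self {M : ℕ} {Mi : Fin M → Finset (Fin M)} {w σ : Fin M → Fin M → ℝ}
    {ρ ε γ : ℝ} {Pe : Fin M → Setoid (Fin M)} {i : Fin M} (hi : i ∉ Mi i)
    (hw_nonneg : ∀ j, 0 ≤ w i j) (hε : 0 ≤ ε)
    (hcons : ∀ j ∈ Mi i, w i j * |delta (Pe i) i j - delta (Pe j) i j| = 0)
    (hργ : ∀ j, ρ * σ i j ≤ γ) {C : Setoid (Fin M)} (hrefine : Refines C (Pe i))
    (hεsmall : γ * ε * ∑ j ∈ Mi i, (delta C i j - delta (Pe i) i j)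
      ≤ (1 - γ) * ∑ j ∈ Mi i, w i j * (delta C i j - delta (Pe i) i j)) :
    Jcost Mi w σ ρ ε i Pe ≤ Jcost Mi w σ ρ ε i (Function.update Pe i C) := by
  have hd (j : Fin M) : 0 ≤ delta C i j - delta (Pe i) i j :=
    sub_nonneg.2 (hrefine.delta_le i j)
  have hconsensus : ∑ j ∈ Mi i, w i j * |delta C i j - delta (Function.update Pe i C j) i j|
      = ∑ j ∈ Mi i, w i j * (delta C i j - delta (Pe i) i j) := by
    refine Finset.sum_congr rfl fun j hj => ?_
    rw [Function.update_of_ne (ne_of_mem_of_not_mem hj hi)]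
    rcases mul_eq_zero.1 (hcons j hj) with h | h
    · simp [h]
    · rw [← sub_eq_zero.1 (abs_eq_zero.1 h), abs_of_nonneg (hd j)]
  have hpower : ρ * ∑ j ∈ Mi i, (w i j + ε) * σ i j * (1 - delta (Pe i) i j)
      - ρ * ∑ j ∈ Mi i, (w i j + ε) * σ i j * (1 - delta C i j)
      ≤ γ * ∑ j ∈ Mi i, w i j * (delta C i j - delta (Pe i) i j)
        + γ * ε * ∑ j ∈ Mi i, (delta C i j - delta (Pe i) i j) := by
    simp only [Finset.mul_sum, ← Finset.sum_sub_distrib, ← Finset.sum_add_distrib]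
    refine Finset.sum_le_sum fun j _ => ?_
    have := mul_le_mul_of_nonneg_right (hργ j)
      (mul_nonneg (add_nonneg (hw_nonneg j) hε) (hd j))
    linarith
  unfold Jcost
  rw [Function.update_self, Finset.sum_eq_zero hcons, hconsensus]
  linarith

/-- **Refinement case in the proof of Theorem 4.** At a zero-consensus profile `Pe`, with
`ρσ_{ij} ≤ γ < 1` and `ε` small enough (in the precise sense below), a refinement
deviation by subsystem `i` cannot decrease the potential. -/
theorem refinement_does_not_decrease_potential {M : ℕ} (hM : 1 ≤ M)
    (Mi : Fin M → Finset (Fin M)) (w σ : Fin M → Fin M → ℝ) (ρ ε : ℝ)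
    (hMi_irrefl : ∀ i, i ∉ Mi i)
    (hMi_symm : ∀ i j, j ∈ Mi i ↔ i ∈ Mi j)
    (hw_symm : ∀ i j, w i j = w j i) (hw_nonneg : ∀ i j, 0 ≤ w i j)
    (hσ_symm : ∀ i j, σ i j = σ j i) (hσ_pos : ∀ i j, 0 < σ i j)
    (hρ : 0 < ρ) (hε : 0 ≤ ε)
    (Pe : Fin M → Setoid (Fin M))
    (hcons : ∀ i, ∀ j ∈ Mi i, w i j * |delta (Pe i) i j - delta (Pe j) i j| = 0)
    (γ : ℝ) (hγ0 : 0 < γ) (hγ1 : γ < 1) (hργ : ∀ i j, ρ * σ i j ≤ γ)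
    (i : Fin M) (C : Setoid (Fin M)) (hrefine : Refines C (Pe i))
    (hεsmall : γ * ε * ∑ j ∈ Mi i, (delta C i j - delta (Pe i) i j)
      ≤ (1 - γ) * ∑ j ∈ Mi i, w i j * (delta C i j - delta (Pe i) i j)) :
    potential Mi w σ ρ ε Pe ≤ potential Mi w σ ρ ε (Function.update Pe i C) := by
  unfold potential
  gcongr with k
  by_cases hki : k = i
  · subst hki
    exact Jcost_le_update_self (hMi_irrefl k) (hw_nonneg k) hε (hcons k) (hργ k) hrefine hεsmall
  · exact Jcost_le_update_of_ne hki (hw_nonneg k) (hcons k) C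

end ConsensusGame
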